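/- Let σ_x = [[0,1],[1,0]], σ_z = [[1,0],[0,−1]], G_α := (sin α)σ_x + (cos α)σ_z, and ρ_e := (1/2)·[[1,0,0,1],[0,0,0,0],[0,0,0,0],[1,0,0,1]]. With α₁ = π/2, α₂ = 0, β₁ = π/4, β₂ = −π/4, the CHSH operator S := G_{α₁}⊗G_{β₁} − G_{α₁}⊗G_{β₂} + G_{α₂}⊗G_{β₁} + G_{α₂}⊗G_{β₂} satisfies Tr(S ρ_e) = 2√2; in particular Tr(S ρ_e) > 2, violating the CHSH bound that holds for all product states. -/

import Mathlib

open Matrix Kronecker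
open scoped ComplexOrder

noncomputable section

/-- The Pauli matrix `σ_x`. -/
def sigmaX : Matrix (Fin 2) (Fin 2) ℂ := !![0, 1; 1, 0]

/-- The Pauli matrix `σ_z`. -/
def sigmaZ : Matrix (Fin 2) (Fin 2) ℂ := !![1, 0; 0, -1]

/-- `G_α = sin(α) σ_x + cos(α) σ_z`. -/
def Gmat (α : ℝ) : Matrix (Fin 2) (Fin 2) ℂ :=
  (Real.sin α : ℂ) • sigmaX + (Real.cos α : ℂ) • sigmaZ

/-- The CHSH operator with `α₁ = π/2`, `α₂ = 0`, `β₁ = π/4`, `β₂ = −π/4`: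
`S = G_{α₁}⊗G_{β₁} − G_{α₁}⊗G_{β₂} + G_{α₂}⊗G_{β₁} + G_{α₂}⊗G_{β₂}`. -/
def chshS : Matrix (Fin 2 × Fin 2) (Fin 2 × Fin 2) ℂ :=
  Gmat (Real.pi / 2) ⊗ₖ Gmat (Real.pi / 4) -
    Gmat (Real.pi / 2) ⊗ₖ Gmat (-(Real.pi / 4)) +
    Gmat 0 ⊗ₖ Gmat (Real.pi / 4) + Gmat 0 ⊗ₖ Gmat (-(Real.pi / 4))

/-- The entangled state `ρ_e = ½ (|00⟩+|11⟩)(⟨00|+⟨11|)`, indexed by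
`Fin 2 × Fin 2` in the ordering `(0,0),(0,1),(1,0),(1,1)` (so it equals
`½ [[1,0,0,1],[0,0,0,0],[0,0,0,0],[1,0,0,1]]`). -/
def rhoE : Matrix (Fin 2 × Fin 2) (Fin 2 × Fin 2) ℂ :=
  (1 / 2 : ℂ) • Matrix.of fun p q : Fin 2 × Fin 2 =>
    (if p.1 = p.2 then (1 : ℂ) else 0) * (if q.1 = q.2 then 1 else 0)

/-- The correlation of `G_α` and `G_β` in the entangled state is `cos (α - β)`. -/
theorem trace_kronecker_Gmat_mul_rhoE (α β : ℝ) :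
    ((Gmat α ⊗ₖ Gmat β) * rhoE).trace = (Real.cos (α - β) : ℂ) := by
  rw [Real.cos_sub]
  simp only [Matrix.trace, Matrix.diag, Matrix.mul_apply, Fintype.sum_prod_type, Fin.sum_univ_two]
  simp [Gmat, sigmaX, sigmaZ, rhoE]
  ring

theorem trace_chshS_mul_rhoE : (chshS * rhoE).trace = ((2 * Real.sqrt 2 : ℝ) : ℂ) := by
  have h : Real.cos (Real.pi / 2 - -(Real.pi / 4)) = -(Real.sqrt 2 / 2) := by
    rw [show Real.pi / 2 - -(Real.pi / 4) = Real.pi - Real.pi / 4 by ring, Real.cos_pi_sub,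
      Real.cos_pi_div_four]
  have h' : Real.cos (Real.pi / 2 - Real.pi / 4) = Real.sqrt 2 / 2 := by
    rw [show Real.pi / 2 - Real.pi / 4 = Real.pi / 4 by ring, Real.cos_pi_div_four]
  simp only [chshS, Matrix.add_mul, Matrix.sub_mul, Matrix.trace_add, Matrix.trace_sub,
    trace_kronecker_Gmat_mul_rhoE, h, h', zero_sub, neg_neg, Real.cos_neg, Real.cos_pi_div_four]
  push_cast
  ring

/-- the CHSH operator `S` at the optimal angles satisfies
`Tr(S ρ_e) = 2√2`; in particular `Tr(S ρ_e) > 2`, violating the CHSH bound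
for product states. -/
theorem stmt19 :
    (chshS * rhoE).trace = ((2 * Real.sqrt 2 : ℝ) : ℂ) ∧
      (2 : ℂ) < (chshS * rhoE).trace := by
  refine ⟨trace_chshS_mul_rhoE, ?_⟩
  rw [trace_chshS_mul_rhoE]
  have h : (2 : ℝ) < 2 * Real.sqrt 2 := by
    linarith [Real.one_lt_sqrt_two]
  exact_mod_cast Complex.real_lt_real.mpr h
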